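/- Let n ≥ 2, integers a, b ≥ 0 and 1 ≤ r ≤ n − 1. The ℂ-vector space 𝒴_{a,b,r} = {p ∈ 𝒬_{a,b,r} : ∂z̃† p = 0} has finite dimension y_{a,b,r} = (r/(b+n−r)) · C(n−1, r) · C(a+n−2, a) · C(b+n−1, b), where C(·,·) denotes the binomial coefficient. -/

import Mathlib

noncomputable section

/-- The negative definite quadratic form `-∑ vᵢ²` on `K^m`. -/
def negQ (K : Type) [Field K] (m : ℕ) : QuadraticForm K (Fin m → K) :=
  QuadraticMap.weightedSumSquares K (fun _ : Fin m => (-1 : K))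

/-- The complex Clifford algebra `ℂ_{2n}`, generated by `e_1, …, e_{2n}` with
`e_α e_β + e_β e_α = -2 δ_{αβ}`. -/
abbrev Cl (n : ℕ) : Type := CliffordAlgebra (negQ ℂ (n + n))

/-- The generators `e_α`, `α = 1, …, 2n`, of `ℂ_{2n}`. -/
def e (n : ℕ) (α : Fin (n + n)) : Cl n := CliffordAlgebra.ι (negQ ℂ (n + n)) (Pi.single α 1)

/-- The Witt basis element `𝔣_j = ½(e_j - i e_{n+j})`. -/
def ff (n : ℕ) (j : Fin n) : Cl n :=
  (2⁻¹ : ℂ) • (e n (Fin.castAdd n j) - Complex.I • e n (Fin.natAdd n j))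

/-- The Witt basis element `𝔣_j† = -½(e_j + i e_{n+j})`. -/
def ffd (n : ℕ) (j : Fin n) : Cl n :=
  -((2⁻¹ : ℂ) • (e n (Fin.castAdd n j) + Complex.I • e n (Fin.natAdd n j)))

/-- `f : ℂ^m → ℂ_{2n}` has directional derivative `d` at `z` in direction `v`
(componentwise, i.e. tested against all linear functionals on the finite-dimensional
space `ℂ_{2n}`; here `ℂ^m` is regarded as the real vector space `ℝ^{2m}`). -/
def HasDirDeriv {n m : ℕ} (f : (Fin m → ℂ) → Cl n) (z v : Fin m → ℂ) (d : Cl n) : Prop :=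
  ∀ φ : Cl n →ₗ[ℂ] ℂ, HasDerivAt (fun t : ℝ => φ (f (z + t • v))) (φ d) 0

/-- The directional derivative of `f` at `z` in direction `v` (junk value if none exists). -/
def dirDeriv {n m : ℕ} (f : (Fin m → ℂ) → Cl n) (v : Fin m → ℂ) (z : Fin m → ℂ) : Cl n :=
  letI : Nonempty (Cl n) := ⟨0⟩
  Classical.epsilon fun d => HasDirDeriv f z v d

/-- The Cauchy–Riemann operator `∂_{z_j} = ½(∂_{x_j} - i ∂_{y_j})`. -/
def pz {n m : ℕ} (j : Fin m) (f : (Fin m → ℂ) → Cl n) : (Fin m → ℂ) → Cl n := fun z =>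
  (2⁻¹ : ℂ) • (dirDeriv f (Pi.single j 1) z - Complex.I • dirDeriv f (Pi.single j Complex.I) z)

/-- The conjugate Cauchy–Riemann operator `∂_{z_j^c} = ½(∂_{x_j} + i ∂_{y_j})`. -/
def pzc {n m : ℕ} (j : Fin m) (f : (Fin m → ℂ) → Cl n) : (Fin m → ℂ) → Cl n := fun z =>
  (2⁻¹ : ℂ) • (dirDeriv f (Pi.single j 1) z + Complex.I • dirDeriv f (Pi.single j Complex.I) z)

/-- The Hermitean Dirac operator `∂_z g = ∑_j 𝔣_j† ∂_{z_j} g` on functions `ℂ^n → ℂ_{2n}`. -/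
def dzFull (n : ℕ) (g : (Fin n → ℂ) → Cl n) (z : Fin n → ℂ) : Cl n :=
  ∑ j : Fin n, ffd n j * pz j g z

/-- The Hermitean Dirac operator `∂_z† g = ∑_j 𝔣_j ∂_{z_j^c} g` on functions `ℂ^n → ℂ_{2n}`. -/
def dzdFull (n : ℕ) (g : (Fin n → ℂ) → Cl n) (z : Fin n → ℂ) : Cl n :=
  ∑ j : Fin n, ff n j * pzc j g z

/-- `g : ℂ^n → ℂ_{2n}` is Hermitean monogenic (everywhere). -/
def HMonogenic (n : ℕ) (g : (Fin n → ℂ) → Cl n) : Prop :=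
  ∀ z, dzFull n g z = 0 ∧ dzdFull n g z = 0

/-- The restricted Hermitean Dirac operator `∂_z̃ g = ∑_{j<n} 𝔣_j† ∂_{z_j} g` on functions
`ℂ^{n-1} → ℂ_{2n}`. -/
def dzT (n : ℕ) (g : (Fin (n - 1) → ℂ) → Cl n) (z : Fin (n - 1) → ℂ) : Cl n :=
  ∑ j : Fin (n - 1), ffd n (Fin.castLE (Nat.sub_le n 1) j) * pz j g z

/-- The restricted Hermitean Dirac operator `∂_z̃† g = ∑_{j<n} 𝔣_j ∂_{z_j^c} g` on functions
`ℂ^{n-1} → ℂ_{2n}`. -/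
def dzdT (n : ℕ) (g : (Fin (n - 1) → ℂ) → Cl n) (z : Fin (n - 1) → ℂ) : Cl n :=
  ∑ j : Fin (n - 1), ff n (Fin.castLE (Nat.sub_le n 1) j) * pzc j g z

/-- `p : ℂ^m → ℂ_{2n}` is a polynomial map (in the underlying real coordinates,
equivalently in `z_j` and their conjugates) with coefficients in `ℂ_{2n}`. -/
def IsPolyMap (n m : ℕ) (p : (Fin m → ℂ) → Cl n) : Prop :=
  ∃ (N : ℕ) (c : Fin N → Cl n) (dx dy : Fin N → Fin m → ℕ),
    ∀ z, p z = ∑ t, (∏ j, (z j) ^ dx t j * (starRingEnd ℂ) (z j) ^ dy t j) • c t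

/-- `p : ℂ^m → ℂ_{2n}` is a homogeneous polynomial of bidegree `(a, b)`:
it is polynomial and `p (c z) = c^a (conj c)^b p(z)`. -/
def IsBihom (n m a b : ℕ) (p : (Fin m → ℂ) → Cl n) : Prop :=
  IsPolyMap n m p ∧ ∀ (c : ℂ) (z : Fin m → ℂ),
    p (c • z) = (c ^ a * (starRingEnd ℂ) c ^ b) • p z

/-- The idempotent `I = (𝔣_1 𝔣_1†)(𝔣_2 𝔣_2†) ⋯ (𝔣_n 𝔣_n†)`. -/
def Iel (n : ℕ) : Cl n := ((List.finRange n).map (fun j => ff n j * ffd n j)).prod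

/-- The element `𝔣_{k_1}† ⋯ 𝔣_{k_r}† I` for `s = {k_1 < ⋯ < k_r}`. -/
def blade (n : ℕ) (s : Finset (Fin n)) : Cl n :=
  ((s.sort (· ≤ ·)).map (ffd n)).prod * Iel n

/-- The homogeneous part `(∧_n†)^{(r)} I` of spinor space. -/
def Lam (n r : ℕ) : Submodule ℂ (Cl n) :=
  Submodule.span ℂ {x | ∃ s : Finset (Fin n), s.card = r ∧ x = blade n s}

/-- The subspace `(∧_{n-1}†)^{(r)}(𝔣_1†,…,𝔣_{n-1}†) I` (all indices `≤ n-1`). -/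
def LamT (n r : ℕ) : Submodule ℂ (Cl n) :=
  Submodule.span ℂ
    {x | ∃ s : Finset (Fin n), s.card = r ∧ (∀ j ∈ s, (j : ℕ) + 1 < n) ∧ x = blade n s}

/-- The subspace `(∧_{n-1}†)^{(r-1)}(𝔣_1†,…,𝔣_{n-1}†) 𝔣_n† I`: the span of the blades
`𝔣_{k_1}† ⋯ 𝔣_{k_{r-1}}† 𝔣_n† I` with `k_1 < ⋯ < k_{r-1} ≤ n-1`, i.e. of the `r`-blades
whose index set contains `n`. -/
def LamQ (n r : ℕ) : Submodule ℂ (Cl n) :=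
  Submodule.span ℂ
    {x | ∃ s : Finset (Fin n), s.card = r ∧ (∃ j ∈ s, (j : ℕ) + 1 = n) ∧ x = blade n s}

/-- The embedding `ℂ^{n-1} ≃ {z ∈ ℂ^n : z_n = 0} ⊆ ℂ^n`. -/
def embC (n : ℕ) (x : Fin (n - 1) → ℂ) : Fin n → ℂ :=
  fun i => if h : (i : ℕ) < n - 1 then x ⟨i, h⟩ else 0

open TensorProduct

section Clifford

variable {n : ℕ}

/-- The vector representing `𝔣_j`. -/
def ffVec (n : ℕ) (j : Fin n) : Fin (n + n) → ℂ :=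
  (2⁻¹ : ℂ) • (Pi.single (Fin.castAdd n j) 1 - Complex.I • Pi.single (Fin.natAdd n j) 1)

/-- The vector representing `𝔣_j†`. -/
def ffdVec (n : ℕ) (j : Fin n) : Fin (n + n) → ℂ :=
  -((2⁻¹ : ℂ) • (Pi.single (Fin.castAdd n j) 1 + Complex.I • Pi.single (Fin.natAdd n j) 1))

lemma ff_eq_ι (j : Fin n) : ff n j = CliffordAlgebra.ι (negQ ℂ (n + n)) (ffVec n j) := by
  simp only [ff, ffVec, e, map_smul, map_sub]

lemma ffd_eq_ι (j : Fin n) : ffd n j = CliffordAlgebra.ι (negQ ℂ (n + n)) (ffdVec n j) := by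
  simp only [ffd, ffdVec, e, map_neg, map_smul, map_add]

lemma polar_negQ (m : ℕ) (v w : Fin m → ℂ) :
    QuadraticMap.polar (negQ ℂ m) v w = -2 * ∑ i, v i * w i := by
  simp only [QuadraticMap.polar, negQ, QuadraticMap.weightedSumSquares_apply, Pi.add_apply,
    ← Finset.sum_sub_distrib, Finset.mul_sum]
  refine Finset.sum_congr rfl fun i _ => ?_
  simp only [smul_eq_mul]
  ring

lemma single_castAdd_natAdd (j k : Fin n) :
    (Pi.single (Fin.castAdd n j) 1 : Fin (n + n) → ℂ) (Fin.natAdd n k) = 0 :=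
  Pi.single_eq_of_ne (fun h => by have := congrArg Fin.val h; simp at this; omega) _

lemma single_natAdd_castAdd (j k : Fin n) :
    (Pi.single (Fin.natAdd n j) 1 : Fin (n + n) → ℂ) (Fin.castAdd n k) = 0 :=
  Pi.single_eq_of_ne (fun h => by have := congrArg Fin.val h; simp at this; omega) _

lemma single_castAdd_castAdd (j k : Fin n) :
    (Pi.single (Fin.castAdd n j) 1 : Fin (n + n) → ℂ) (Fin.castAdd n k) =
      if k = j then 1 else 0 := by
  simp [Pi.single_apply]

lemma single_natAdd_natAdd (j k : Fin n) :
    (Pi.single (Fin.natAdd n j) 1 : Fin (n + n) → ℂ) (Fin.natAdd n k) =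
      if k = j then 1 else 0 := by
  simp [Pi.single_apply]

lemma polar_ffVec_ffVec (i j : Fin n) :
    QuadraticMap.polar (negQ ℂ (n + n)) (ffVec n i) (ffVec n j) = 0 := by
  rw [polar_negQ, Fin.sum_univ_add]
  simp only [ffVec, Pi.smul_apply, Pi.sub_apply, single_castAdd_natAdd, single_natAdd_castAdd,
    single_castAdd_castAdd, single_natAdd_natAdd, smul_eq_mul, mul_ite]
  by_cases h : i = j
  · subst h
    simp
    linear_combination (1/4 : ℂ) * Complex.I_mul_I
  · simp [Ne.symm h]

lemma polar_ffdVec_ffdVec (i j : Fin n) :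
    QuadraticMap.polar (negQ ℂ (n + n)) (ffdVec n i) (ffdVec n j) = 0 := by
  rw [polar_negQ, Fin.sum_univ_add]
  simp only [ffdVec, Pi.neg_apply, Pi.smul_apply, Pi.add_apply, single_castAdd_natAdd,
    single_natAdd_castAdd,
    single_castAdd_castAdd, single_natAdd_natAdd, smul_eq_mul, mul_ite]
  by_cases h : i = j
  · subst h
    simp
    linear_combination (1/4 : ℂ) * Complex.I_mul_I
  · simp [Ne.symm h]

lemma polar_ffVec_ffdVec (i j : Fin n) :
    QuadraticMap.polar (negQ ℂ (n + n)) (ffVec n i) (ffdVec n j) = if i = j then 1 else 0 := by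
  rw [polar_negQ, Fin.sum_univ_add]
  simp only [ffVec, ffdVec, Pi.neg_apply, Pi.smul_apply, Pi.add_apply, Pi.sub_apply,
    single_castAdd_natAdd, single_natAdd_castAdd,
    single_castAdd_castAdd, single_natAdd_natAdd, smul_eq_mul, mul_ite]
  by_cases h : i = j
  · subst h
    simp
    linear_combination (-1/2 : ℂ) * Complex.I_mul_I
  · simp [h, Ne.symm h]

lemma ff_mul_ff (i j : Fin n) : ff n i * ff n j = -(ff n j * ff n i) := by
  have h := CliffordAlgebra.ι_mul_ι_add_swap (Q := negQ ℂ (n + n)) (ffVec n i) (ffVec n j)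
  rw [polar_ffVec_ffVec, map_zero] at h
  rw [ff_eq_ι, ff_eq_ι]
  exact eq_neg_of_add_eq_zero_left h

lemma ffd_mul_ffd (i j : Fin n) : ffd n i * ffd n j = -(ffd n j * ffd n i) := by
  have h := CliffordAlgebra.ι_mul_ι_add_swap (Q := negQ ℂ (n + n)) (ffdVec n i) (ffdVec n j)
  rw [polar_ffdVec_ffdVec, map_zero] at h
  rw [ffd_eq_ι, ffd_eq_ι]
  exact eq_neg_of_add_eq_zero_left h

lemma ff_mul_ffd (i j : Fin n) :
    ff n i * ffd n j = (if i = j then 1 else 0) - ffd n j * ff n i := by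
  have h := CliffordAlgebra.ι_mul_ι_add_swap (Q := negQ ℂ (n + n)) (ffVec n i) (ffdVec n j)
  rw [polar_ffVec_ffdVec] at h
  rw [ff_eq_ι, ffd_eq_ι, eq_sub_iff_add_eq, h]
  split_ifs <;> simp

lemma eq_zero_of_eq_neg {x : Cl n} (h : x = -x) : x = 0 := by
  have h2 : (2 : ℂ) • x = 0 := by rw [two_smul, add_eq_zero_iff_eq_neg, ← h]
  exact (smul_eq_zero.mp h2).resolve_left two_ne_zero

lemma ff_mul_self (j : Fin n) : ff n j * ff n j = 0 :=
  eq_zero_of_eq_neg (ff_mul_ff j j)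

lemma ffd_mul_self (j : Fin n) : ffd n j * ffd n j = 0 :=
  eq_zero_of_eq_neg (ffd_mul_ffd j j)

lemma ff_mul_ffd_of_ne {i j : Fin n} (h : i ≠ j) : ff n i * ffd n j = -(ffd n j * ff n i) := by
  rw [ff_mul_ffd, if_neg h, zero_sub]

lemma ff_commute_ff_mul_ffd {i j : Fin n} (h : i ≠ j) : Commute (ff n i) (ff n j * ffd n j) := by
  change ff n i * (ff n j * ffd n j) = ff n j * ffd n j * ff n i
  rw [← mul_assoc, ff_mul_ff i j, neg_mul, mul_assoc, ff_mul_ffd_of_ne h, mul_neg, neg_neg,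
    mul_assoc]

lemma commute_vacuum_list {x : Cl n} {l : List (Fin n)}
    (h : ∀ k ∈ l, Commute x (ff n k * ffd n k)) :
    Commute x (l.map fun k => ff n k * ffd n k).prod := by
  refine Commute.list_prod_right _ _ fun y hy => ?_
  obtain ⟨k, hk, rfl⟩ := List.mem_map.mp hy
  exact h k hk

lemma ff_mul_vacuum_list {j : Fin n} {l : List (Fin n)} (h : j ∈ l) :
    ff n j * (l.map fun k => ff n k * ffd n k).prod = 0 := by
  induction l with
  | nil => simp at h
  | cons k l ih =>
    rw [List.map_cons, List.prod_cons]
    by_cases hk : j = k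
    · subst hk
      rw [← mul_assoc, ← mul_assoc, ff_mul_self, zero_mul, zero_mul]
    · rw [← mul_assoc, (ff_commute_ff_mul_ffd hk).eq, mul_assoc,
        ih ((List.mem_cons.mp h).resolve_left hk), mul_zero]

lemma ff_mul_Iel (j : Fin n) : ff n j * Iel n = 0 :=
  ff_mul_vacuum_list (List.mem_finRange j)

instance : Nontrivial (Cl n) :=
  letI : Invertible (2 : ℂ) := invertibleOfNonzero two_ne_zero
  inferInstance

lemma vacuum_list_ne_zero {l : List (Fin n)} (h : l.Nodup) :
    (l.map fun k => ff n k * ffd n k).prod ≠ 0 := by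
  induction l with
  | nil => simp
  | cons j l ih =>
    obtain ⟨hj, hl⟩ := List.nodup_cons.mp h
    rw [List.map_cons, List.prod_cons]
    set y := (l.map fun k => ff n k * ffd n k).prod with hy
    have hne : ∀ k ∈ l, j ≠ k := fun k hk hjk => hj (hjk ▸ hk)
    have hcomm : Commute (ff n j) y :=
      commute_vacuum_list fun k hk => ff_commute_ff_mul_ffd (hne k hk)
    intro h0
    have hfd : ffd n j * y = 0 := by
      have h1 : ffd n j * ((ff n j * ffd n j) * y) = 0 := by rw [h0, mul_zero]
      have h2 : ffd n j * (ff n j * ffd n j) = ffd n j := by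
        rw [ff_mul_ffd, if_pos rfl, mul_sub, mul_one, ← mul_assoc, ffd_mul_self, zero_mul,
          sub_zero]
      rwa [← mul_assoc, h2] at h1
    apply ih hl
    have h3 : ff n j * ffd n j * y = y - ffd n j * (ff n j * y) := by
      rw [ff_mul_ffd, if_pos rfl, sub_mul, one_mul, mul_assoc]
    rw [h0, hcomm.eq, ← mul_assoc, hfd, zero_mul, sub_zero] at h3
    exact h3.symm

lemma Iel_ne_zero : Iel n ≠ 0 := vacuum_list_ne_zero (List.nodup_finRange n)

lemma ffd_list_perm {l l' : List (Fin n)} (h : l.Perm l') :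
    (l.map (ffd n)).prod = (l'.map (ffd n)).prod ∨
      (l.map (ffd n)).prod = -(l'.map (ffd n)).prod := by
  induction h with
  | nil => exact Or.inl rfl
  | cons x _ ih =>
    rcases ih with ih | ih
    · left; simp [ih]
    · right; simp [ih]
  | swap x y l =>
    right
    simp only [List.map_cons, List.prod_cons, ← mul_assoc]
    rw [ffd_mul_ffd y x, neg_mul]
  | trans _ _ ih₁ ih₂ =>
    rcases ih₁ with h₁ | h₁ <;> rcases ih₂ with h₂ | h₂ <;> simp [h₁, h₂]

lemma ff_mul_ffd_list {j : Fin n} {l : List (Fin n)} (h : j ∉ l) :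
    ff n j * (l.map (ffd n)).prod = (l.map (ffd n)).prod * ff n j ∨
      ff n j * (l.map (ffd n)).prod = -((l.map (ffd n)).prod * ff n j) := by
  induction l with
  | nil => simp
  | cons k l ih =>
    rw [List.mem_cons, not_or] at h
    simp only [List.map_cons, List.prod_cons, ← mul_assoc]
    rw [ff_mul_ffd_of_ne h.1]
    rcases ih h.2 with ih | ih
    · right; rw [neg_mul, mul_assoc, ih, mul_assoc]
    · left; rw [neg_mul, mul_assoc, ih, mul_neg, neg_neg, mul_assoc]

lemma ffd_mul_ffd_list {j : Fin n} {l : List (Fin n)} (h : j ∈ l) :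
    ffd n j * (l.map (ffd n)).prod = 0 := by
  induction l with
  | nil => simp at h
  | cons k l ih =>
    rw [List.map_cons, List.prod_cons, ← mul_assoc]
    by_cases hk : j = k
    · rw [hk, ffd_mul_self, zero_mul]
    · rw [ffd_mul_ffd, neg_mul, mul_assoc, ih ((List.mem_cons.mp h).resolve_left hk), mul_zero,
        neg_zero]

lemma ff_mul_blade_of_notMem {j : Fin n} {s : Finset (Fin n)} (h : j ∉ s) :
    ff n j * blade n s = 0 := by
  have hl : j ∉ s.sort (· ≤ ·) := by simpa using h
  rw [blade, ← mul_assoc]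
  rcases ff_mul_ffd_list hl with h' | h' <;> rw [h'] <;> simp [mul_assoc, ff_mul_Iel]

lemma ffd_mul_blade_of_mem {j : Fin n} {s : Finset (Fin n)} (h : j ∈ s) :
    ffd n j * blade n s = 0 := by
  rw [blade, ← mul_assoc, ffd_mul_ffd_list (by simpa using h), zero_mul]

lemma ffd_mul_blade_of_notMem {j : Fin n} {s : Finset (Fin n)} (h : j ∉ s) :
    ffd n j * blade n s = blade n (insert j s) ∨
      ffd n j * blade n s = -blade n (insert j s) := by
  have hp : (j :: s.sort (· ≤ ·)).Perm ((insert j s).sort (· ≤ ·)) := by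
    rw [List.perm_ext_iff_of_nodup _ (Finset.sort_nodup _ _)]
    · simp
    · simpa using h
  rcases ffd_list_perm hp with h' | h'
  · left; rw [blade, blade, ← h', List.map_cons, List.prod_cons, mul_assoc]
  · right; rw [blade, blade, ← mul_assoc, ← List.prod_cons, ← List.map_cons, h', neg_mul]

lemma ff_mul_ffd_mul_blade (j : Fin n) (s : Finset (Fin n)) :
    ff n j * (ffd n j * blade n s) = if j ∈ s then 0 else blade n s := by
  split_ifs with h
  · rw [ffd_mul_blade_of_mem h, mul_zero]
  · rw [← mul_assoc, ff_mul_ffd, if_pos rfl, sub_mul, one_mul, mul_assoc,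
      ff_mul_blade_of_notMem h, mul_zero, sub_zero]

lemma ff_mul_blade_insert {j : Fin n} {s : Finset (Fin n)} (h : j ∉ s) :
    ff n j * blade n (insert j s) = blade n s ∨ ff n j * blade n (insert j s) = -blade n s := by
  have h1 := ff_mul_ffd_mul_blade j s
  rw [if_neg h] at h1
  rcases ffd_mul_blade_of_notMem h with h' | h' <;> rw [h'] at h1
  · exact Or.inl h1
  · right; rw [← h1, mul_neg, neg_neg]

lemma blade_ne_zero (s : Finset (Fin n)) : blade n s ≠ 0 := by
  induction s using Finset.induction_on with
  | empty => simpa [blade] using Iel_ne_zero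
  | insert j s hj ih =>
    intro h0
    apply ih
    rcases ff_mul_blade_insert hj with h | h <;> simpa [h0] using h.symm

lemma linearIndependent_blade : LinearIndependent ℂ (blade n) := by
  let N : Module.End ℂ (Cl n) := ∑ j : Fin n, (2 ^ (j : ℕ) : ℂ) •
    (LinearMap.mulLeft ℂ (ff n j * ffd n j))
  refine Module.End.eigenvectors_linearIndependent' N
    (fun s => ((∑ j ∈ sᶜ.map Fin.valEmbedding, 2 ^ j : ℕ) : ℂ)) ?_ (blade n) ?_
  · intro s t hst
    have h := Finset.geomSum_injective le_rfl (Nat.cast_injective hst)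
    simpa using h
  · intro s
    refine ⟨Module.End.mem_eigenspace_iff.mpr ?_, blade_ne_zero s⟩
    simp only [N, LinearMap.sum_apply, LinearMap.smul_apply, LinearMap.mulLeft_apply, mul_assoc,
      ff_mul_ffd_mul_blade, Finset.sum_map, Fin.valEmbedding_apply, Nat.cast_sum, Nat.cast_pow,
      Nat.cast_ofNat, Finset.sum_smul]
    rw [← Finset.sum_subset (Finset.subset_univ sᶜ)]
    · refine Finset.sum_congr rfl fun j hj => ?_
      rw [if_neg (Finset.mem_compl.mp hj)]
    · intro j _ hj
      rw [if_pos (by simpa using hj), smul_zero]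

/-- The blades spanning `LamQ n r`. -/
abbrev LamQIndex (n r : ℕ) : Type :=
  {s : Finset (Fin n) // s.card = r ∧ ∃ j ∈ s, (j : ℕ) + 1 = n}

lemma blade_mem_LamQ {r : ℕ} {s : Finset (Fin n)} (hs : s.card = r)
    (hs' : ∃ j ∈ s, (j : ℕ) + 1 = n) : blade n s ∈ LamQ n r :=
  Submodule.subset_span ⟨s, hs, hs', rfl⟩

lemma span_range_blade (n r : ℕ) :
    Submodule.span ℂ (Set.range fun s : LamQIndex n r => blade n s) = LamQ n r := by
  rw [LamQ]
  congr 1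
  ext x
  constructor
  · rintro ⟨s, rfl⟩
    exact ⟨s, s.2.1, s.2.2, rfl⟩
  · rintro ⟨s, h1, h2, rfl⟩
    exact ⟨⟨s, h1, h2⟩, rfl⟩

/-- The blades as a basis of `LamQ n r`. -/
def basisLamQ (n r : ℕ) : Module.Basis (LamQIndex n r) ℂ (LamQ n r) :=
  (Module.Basis.span (linearIndependent_blade.comp (fun s : LamQIndex n r => (s : Finset (Fin n)))
    Subtype.val_injective)).map (LinearEquiv.ofEq _ _ (span_range_blade n r))

lemma basisLamQ_apply (r : ℕ) (s : LamQIndex n r) :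
    (basisLamQ n r s : Cl n) = blade n s := by
  simp [basisLamQ, Module.Basis.span_apply]

lemma ff_mul_ffd_mul_mem_LamQ {r : ℕ} {i : Fin n} (hi : (i : ℕ) + 1 ≠ n) (j : Fin n)
    {x : Cl n} (hx : x ∈ LamQ n r) : ff n i * ffd n j * x ∈ LamQ n r := by
  have key : LamQ n r ≤ (LamQ n r).comap (LinearMap.mulLeft ℂ (ff n i * ffd n j)) := by
    rw [LamQ, Submodule.span_le]
    rintro _ ⟨s, hs, ⟨l, hl, hln⟩, rfl⟩
    change ff n i * ffd n j * blade n s ∈ LamQ n r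
    rw [mul_assoc]
    by_cases hj : j ∈ s
    · rw [ffd_mul_blade_of_mem hj, mul_zero]
      exact zero_mem _
    have hmem : ff n i * blade n (insert j s) ∈ LamQ n r := by
      by_cases hi' : i ∈ insert j s
      · have hli : l ≠ i := by rintro rfl; exact hi hln
        have hb := ff_mul_blade_insert (Finset.notMem_erase i (insert j s))
        rw [Finset.insert_erase hi'] at hb
        have hb' : blade n ((insert j s).erase i) ∈ LamQ n r := by
          refine blade_mem_LamQ ?_ ⟨l, ?_, hln⟩
          · rw [Finset.card_erase_of_mem hi', Finset.card_insert_of_notMem hj, hs]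
            rfl
          · simp [hli, hl]
        rcases hb with hb | hb <;> rw [hb]
        · exact hb'
        · exact neg_mem hb'
      · rw [ff_mul_blade_of_notMem hi']
        exact zero_mem _
    rcases ffd_mul_blade_of_notMem hj with h | h <;> rw [h]
    · exact hmem
    · rw [mul_neg]
      exact neg_mem hmem
  exact key hx

end Clifford

section Evaluation

open MvPolynomial

variable {m : ℕ}

/-- Polynomials in the variables `z_j` (left summand) and `z_j^c` (right summand). -/
abbrev BiPoly (m : ℕ) : Type := MvPolynomial (Fin m ⊕ Fin m) ℂ

/-- The values of the variables `z_j` and `z_j^c` at the point `z`. -/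
def conjPair (z : Fin m → ℂ) : Fin m ⊕ Fin m → ℂ :=
  Sum.elim z fun j => (starRingEnd ℂ) (z j)

lemma eq_zero_of_eval_conjPair {P : BiPoly m} (h : ∀ z, eval (conjPair z) P = 0) : P = 0 := by
  let φ : BiPoly m →ₐ[ℂ] BiPoly m := aeval (Sum.elim
    (fun j => X (Sum.inl j) + C Complex.I * X (Sum.inr j))
    (fun j => X (Sum.inl j) - C Complex.I * X (Sum.inr j)))
  let ψ : BiPoly m →ₐ[ℂ] BiPoly m := aeval (Sum.elim
    (fun j => C 2⁻¹ * (X (Sum.inl j) + X (Sum.inr j)))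
    (fun j => C (2⁻¹ * -Complex.I) * (X (Sum.inl j) - X (Sum.inr j))))
  have hψφ : ψ.comp φ = AlgHom.id ℂ (BiPoly m) := by
    have hI : (C Complex.I * C Complex.I : BiPoly m) = -1 := by
      rw [← C_mul, Complex.I_mul_I, C_neg, C_1]
    have h2 : (C 2⁻¹ + C 2⁻¹ : BiPoly m) = 1 := by
      rw [← C_add, ← C_1]; norm_num
    refine algHom_ext fun i => ?_
    rcases i with j | j
    · simp only [φ, ψ, AlgHom.comp_apply, aeval_X, Sum.elim_inl, Sum.elim_inr, map_add, map_mul,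
        algHom_C, AlgHom.id_apply, C_neg, algebraMap_eq]
      linear_combination (-(C 2⁻¹ * (X (Sum.inl j) - X (Sum.inr j))) : BiPoly m) * hI +
        X (Sum.inl j) * h2
    · simp only [φ, ψ, AlgHom.comp_apply, aeval_X, Sum.elim_inl, Sum.elim_inr, map_sub, map_mul,
        algHom_C, AlgHom.id_apply, C_neg, algebraMap_eq]
      linear_combination ((C 2⁻¹ * (X (Sum.inl j) - X (Sum.inr j))) : BiPoly m) * hI +
        X (Sum.inr j) * h2
  have hφ : φ P = 0 := by
    refine funext_set (fun _ => Set.range ((↑) : ℝ → ℂ))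
      (fun _ => Set.infinite_range_of_injective Complex.ofReal_injective) fun w hw => ?_
    have hw' : ∀ i, ∃ x : ℝ, (x : ℂ) = w i := fun i => hw i (Set.mem_univ i)
    choose x hx using hw'
    rw [map_zero, ← h fun j => w (Sum.inl j) + Complex.I * w (Sum.inr j)]
    simp only [φ, ← aeval_eq_eval]
    change (aeval w) ((aeval _) P) = _
    rw [← AlgHom.comp_apply, comp_aeval]
    congr 2
    funext i
    rcases i with j | j
    · simp [conjPair]
    · simp [conjPair, ← hx, sub_eq_add_neg]
  have := congrArg (fun f : BiPoly m →ₐ[ℂ] BiPoly m => f P) hψφ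
  simpa [hφ] using this.symm

/-- Evaluation of formal polynomials with coefficients in `ℂ_{2n}`. -/
def evalCl (n m : ℕ) : BiPoly m ⊗[ℂ] Cl n →ₗ[ℂ] ((Fin m → ℂ) → Cl n) :=
  LinearMap.pi fun z =>
    TensorProduct.lift ((LinearMap.lsmul ℂ (Cl n)).comp (aeval (conjPair z)).toLinearMap)

variable {n : ℕ}

@[simp]
lemma evalCl_tmul (P : BiPoly m) (x : Cl n) (z : Fin m → ℂ) :
    evalCl n m (P ⊗ₜ x) z = eval (conjPair z) P • x := by
  simp [evalCl, aeval_eq_eval]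

lemma evalCl_injective : Function.Injective (evalCl n m) := by
  rw [← LinearMap.ker_eq_bot, LinearMap.ker_eq_bot']
  intro w hw
  classical
  let B := Module.Basis.ofVectorSpace ℂ (Cl n)
  have key : ∀ (k) (z : Fin m → ℂ) (w : BiPoly m ⊗[ℂ] Cl n),
      eval (conjPair z) (TensorProduct.equivFinsuppOfBasisRight B w k) =
        B.coord k (evalCl n m w z) := by
    intro k z w
    induction w using TensorProduct.induction_on with
    | zero => simp
    | tmul P x =>
      simp [mul_comm]
    | add u v hu hv => simp only [map_add, Finsupp.add_apply, Pi.add_apply, hu, hv]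
  apply (TensorProduct.equivFinsuppOfBasisRight B).injective
  rw [map_zero]
  ext1 k
  refine eq_zero_of_eval_conjPair fun z => ?_
  rw [key, hw]
  simp

lemma map_mulLeft_evalCl (y : Cl n) (w : BiPoly m ⊗[ℂ] Cl n) (z : Fin m → ℂ) :
    y * evalCl n m w z =
      evalCl n m (TensorProduct.map LinearMap.id (LinearMap.mulLeft ℂ y) w) z := by
  induction w using TensorProduct.induction_on with
  | zero => simp
  | tmul P x => simp
  | add u v hu hv => simp only [map_add, Pi.add_apply, mul_add, hu, hv]

/-- The derivation of formal polynomials corresponding to differentiation in direction `v`. -/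
def dirDerivation (v : Fin m → ℂ) : Derivation ℂ (BiPoly m) (BiPoly m) :=
  mkDerivation ℂ fun i => C (conjPair v i)

lemma hasDerivAt_eval_conjPair (z v : Fin m → ℂ) (P : BiPoly m) :
    HasDerivAt (fun t : ℝ => eval (conjPair (z + t • v)) P)
      (eval (conjPair z) (dirDerivation v P)) 0 := by
  induction P using MvPolynomial.induction_on with
  | C a =>
    simpa [derivation_C] using hasDerivAt_const (0 : ℝ) a
  | add p q hp hq =>
    simpa using hp.fun_add hq
  | mul_X p i hp =>
    have hX : HasDerivAt (fun t : ℝ => conjPair (z + t • v) i) (conjPair v i) 0 := by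
      have hlin : ∀ u w : ℂ, HasDerivAt (fun t : ℝ => u + (t : ℂ) * w) w 0 := fun u w => by
        simpa using ((Complex.ofRealCLM.hasDerivAt (x := 0)).mul_const w).const_add u
      rcases i with j | j
      · simpa [conjPair] using hlin (z j) (v j)
      · simpa [conjPair] using hlin ((starRingEnd ℂ) (z j)) ((starRingEnd ℂ) (v j))
    have := hp.fun_mul hX
    simp only [zero_smul, add_zero] at this
    simp only [eval_mul, eval_X, Derivation.leibniz, smul_eq_mul, map_add]
    refine this.congr_deriv ?_
    simp only [dirDerivation, mkDerivation_X, eval_C]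
    ring

lemma hasDirDeriv_evalCl (w : BiPoly m ⊗[ℂ] Cl n) (z v : Fin m → ℂ) :
    HasDirDeriv (evalCl n m w) z v
      (evalCl n m (TensorProduct.map (dirDerivation v).toLinearMap LinearMap.id w) z) := by
  intro φ
  induction w using TensorProduct.induction_on with
  | zero => simpa using hasDerivAt_const (0 : ℝ) (0 : ℂ)
  | tmul P x => simpa using (hasDerivAt_eval_conjPair z v P).mul_const (φ x)
  | add u v hu hv => simpa using hu.fun_add hv

lemma HasDirDeriv.unique {f : (Fin m → ℂ) → Cl n} {z v : Fin m → ℂ} {d d' : Cl n}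
    (h : HasDirDeriv f z v d) (h' : HasDirDeriv f z v d') : d = d' := by
  rw [← sub_eq_zero, ← Module.forall_dual_apply_eq_zero_iff ℂ]
  intro φ
  rw [map_sub, sub_eq_zero]
  exact (h φ).unique (h' φ)

lemma HasDirDeriv.dirDeriv_eq {f : (Fin m → ℂ) → Cl n} {z v : Fin m → ℂ} {d : Cl n}
    (h : HasDirDeriv f z v d) : dirDeriv f v z = d :=
  letI : Nonempty (Cl n) := ⟨0⟩
  (Classical.epsilon_spec ⟨d, h⟩ : HasDirDeriv f z v (dirDeriv f v z)).unique h

lemma dirDerivation_single_one (j : Fin m) :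
    dirDerivation (Pi.single j 1) = pderiv (Sum.inl j) + pderiv (Sum.inr j) := by
  refine derivation_ext fun i => ?_
  rcases i with k | k <;> by_cases h : k = j <;>
    simp [dirDerivation, mkDerivation_X, conjPair, pderiv_X, h]

lemma dirDerivation_single_I (j : Fin m) :
    dirDerivation (Pi.single j Complex.I) =
      Complex.I • (pderiv (Sum.inl j) - pderiv (Sum.inr j)) := by
  refine derivation_ext fun i => ?_
  rcases i with k | k <;> by_cases h : k = j <;>
    simp [dirDerivation, mkDerivation_X, conjPair, pderiv_X, smul_eq_C_mul, h]

lemma pzc_evalCl (j : Fin m) (w : BiPoly m ⊗[ℂ] Cl n) (z : Fin m → ℂ) :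
    pzc j (evalCl n m w) z =
      evalCl n m (TensorProduct.map (pderiv (Sum.inr j)).toLinearMap LinearMap.id w) z := by
  rw [pzc, (hasDirDeriv_evalCl w z _).dirDeriv_eq, (hasDirDeriv_evalCl w z _).dirDeriv_eq,
    dirDerivation_single_one, dirDerivation_single_I]
  induction w using TensorProduct.induction_on with
  | zero => simp
  | tmul P x =>
    simp only [TensorProduct.map_tmul, evalCl_tmul, LinearMap.id_apply, Derivation.coeFn_coe,
      Derivation.add_apply, Derivation.smul_apply, Derivation.sub_apply, map_add, map_sub, smul_eval,
      smul_smul, ← add_smul]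
    congr 1
    linear_combination (2⁻¹ * (eval (conjPair z) (pderiv (Sum.inl j) P) -
      eval (conjPair z) (pderiv (Sum.inr j) P))) * Complex.I_mul_I
  | add u v hu hv =>
    simp only [map_add, Pi.add_apply, ← hu, ← hv]
    module

end Evaluation

section Dimension

open MvPolynomial

variable {m n : ℕ}

/-- The exponents of the monomials of bidegree `(a, b)`. -/
def bidegreeSet (m a b : ℕ) : Set (Fin m ⊕ Fin m →₀ ℕ) :=
  {d | ∑ j, d (Sum.inl j) = a ∧ ∑ j, d (Sum.inr j) = b}

/-- The formal polynomials of bidegree `(a, b)`. -/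
abbrev biHomog (m a b : ℕ) : Submodule ℂ (BiPoly m) := restrictSupport ℂ (bidegreeSet m a b)

/-- An exponent of bidegree `(a, b)` consists of an exponent of degree `a` and one of
degree `b`. -/
def bidegreeSetEquiv (m a b : ℕ) : bidegreeSet m a b ≃
    (Finset.univ : Finset (Fin m)).finsuppAntidiag a ×
      (Finset.univ : Finset (Fin m)).finsuppAntidiag b :=
  (Equiv.subtypeEquiv (q := fun p : (Fin m →₀ ℕ) × (Fin m →₀ ℕ) =>
    p.1 ∈ (Finset.univ : Finset (Fin m)).finsuppAntidiag a ∧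
      p.2 ∈ (Finset.univ : Finset (Fin m)).finsuppAntidiag b)
    Finsupp.sumFinsuppEquivProdFinsupp fun d => by
      simp [bidegreeSet, Finset.mem_finsuppAntidiag]
      rfl).trans
    (Equiv.subtypeProdEquivProd)

instance (m a b : ℕ) : Fintype (bidegreeSet m a b) :=
  Fintype.ofEquiv _ (bidegreeSetEquiv m a b).symm

instance (m a b : ℕ) : Module.Finite ℂ (biHomog m a b) :=
  Module.Finite.of_basis (basisRestrictSupport ℂ _)

instance (r : ℕ) : Module.Finite ℂ (LamQ n r) := Module.Finite.of_basis (basisLamQ n r)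

lemma basisRestrictSupport_repr_apply {s : Set (Fin m ⊕ Fin m →₀ ℕ)}
    (P : restrictSupport ℂ s) (d : s) :
    (basisRestrictSupport ℂ s).repr P d = coeff (d : Fin m ⊕ Fin m →₀ ℕ) (P : BiPoly m) :=
  rfl

lemma basisRestrictSupport_apply {s : Set (Fin m ⊕ Fin m →₀ ℕ)} (d : s) :
    (basisRestrictSupport ℂ s d : BiPoly m) = monomial (d : Fin m ⊕ Fin m →₀ ℕ) 1 := by
  classical
  have h : basisRestrictSupport ℂ s d =
      ⟨monomial (d : Fin m ⊕ Fin m →₀ ℕ) 1, by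
        rw [monomial_mem_restrictSupport]
        exact Or.inl d.2⟩ := by
    apply (basisRestrictSupport ℂ s).repr.injective
    ext d'
    rw [Module.Basis.repr_self, basisRestrictSupport_repr_apply, coeff_monomial,
      Finsupp.single_apply]
    simp only [Subtype.ext_iff]
  rw [h]

lemma card_bidegreeSet (m a b : ℕ) :
    Fintype.card (bidegreeSet m a b) = (m + a - 1).choose a * (m + b - 1).choose b := by
  rw [Fintype.card_congr (bidegreeSetEquiv m a b), Fintype.card_prod, Fintype.card_coe,
    Fintype.card_coe, Finset.card_finsuppAntidiag_nat_eq_choose,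
    Finset.card_finsuppAntidiag_nat_eq_choose, Finset.card_univ, Fintype.card_fin]

lemma pderiv_X_mul_monomial_mem_biHomog {a b : ℕ} (i j : Fin m) {d : Fin m ⊕ Fin m →₀ ℕ}
    (hd : d ∈ bidegreeSet m a b) :
    pderiv (Sum.inr i) (X (Sum.inr j) * monomial d (1 : ℂ)) ∈ biHomog m a b := by
  obtain ⟨hd1, hd2⟩ := hd
  rw [X, monomial_mul, pderiv_monomial, monomial_mem_restrictSupport, or_iff_not_imp_right]
  intro h0
  have hpos : Finsupp.single (Sum.inr i) 1 ≤ Finsupp.single (Sum.inr j) 1 + d := by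
    rw [Finsupp.single_le_iff, Nat.one_le_iff_ne_zero]
    intro h
    exact h0 (by rw [h]; simp)
  set d' := Finsupp.single (Sum.inr j) 1 + d - Finsupp.single (Sum.inr i) 1
  have hadd : d' + Finsupp.single (Sum.inr i) 1 = Finsupp.single (Sum.inr j) 1 + d :=
    tsub_add_cancel_of_le hpos
  have hl : ∀ k, d' (Sum.inl k) = d (Sum.inl k) := fun k => by
    simpa using DFunLike.congr_fun hadd (Sum.inl k)
  have hr : ∀ k, d' (Sum.inr k) + (if i = k then 1 else 0) =
      (if j = k then 1 else 0) + d (Sum.inr k) := fun k => by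
    simpa [Finsupp.single_apply] using DFunLike.congr_fun hadd (Sum.inr k)
  refine ⟨by simpa [hl] using hd1, ?_⟩
  have hsum := Finset.sum_congr (rfl : (Finset.univ : Finset (Fin m)) = _) fun k _ => hr k
  simp only [Finset.sum_add_distrib, Finset.sum_ite_eq, Finset.mem_univ, if_true] at hsum
  omega

lemma pderiv_X_mul_mem_biHomog {a b : ℕ} (i j : Fin m) {P : BiPoly m} (hP : P ∈ biHomog m a b) :
    pderiv (Sum.inr i) (X (Sum.inr j) * P) ∈ biHomog m a b := by
  rw [biHomog, restrictSupport_eq_span] at hP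
  induction hP using Submodule.span_induction with
  | mem P hP =>
    obtain ⟨d, hd, rfl⟩ := hP
    exact pderiv_X_mul_monomial_mem_biHomog i j hd
  | zero =>
    rw [mul_zero, map_zero]
    exact Submodule.zero_mem _
  | add P Q _ _ hP hQ =>
    rw [mul_add, map_add]
    exact Submodule.add_mem _ hP hQ
  | smul c P _ hP =>
    rw [mul_smul_comm, Derivation.map_smul]
    exact Submodule.smul_mem _ c hP

lemma sum_X_mul_pderiv {a b : ℕ} {P : BiPoly m} (hP : P ∈ biHomog m a b) :
    ∑ i, X (Sum.inr i) * pderiv (Sum.inr i) P = (b : ℂ) • P := by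
  have key : Set.EqOn
      (∑ i : Fin m, LinearMap.mulLeft ℂ (X (Sum.inr i)) ∘ₗ (pderiv (Sum.inr i)).toLinearMap :
        BiPoly m →ₗ[ℂ] BiPoly m)
      ((b : ℂ) • LinearMap.id : BiPoly m →ₗ[ℂ] BiPoly m)
      ((fun d => monomial d (1 : ℂ)) '' bidegreeSet m a b) := by
    rintro _ ⟨d, ⟨-, hd⟩, rfl⟩
    simp only [LinearMap.sum_apply, LinearMap.comp_apply, Derivation.coeFn_coe,
      LinearMap.mulLeft_apply, X_mul_pderiv_monomial, LinearMap.smul_apply, LinearMap.id_apply,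
      ← Finset.sum_smul, hd, Nat.cast_smul_eq_nsmul]
  have h := LinearMap.eqOn_span key (x := P) (by rwa [← restrictSupport_eq_span])
  simpa using h

/-- The operator `p ↦ ∂_{z_i^c} (z_j^c p)` on polynomials of bidegree `(a, b)`. -/
def pderivX (m a b : ℕ) (i j : Fin m) : Module.End ℂ (biHomog m a b) :=
  ((pderiv (Sum.inr i)).toLinearMap ∘ₗ LinearMap.mulLeft ℂ (X (Sum.inr j))).restrict
    fun P hP => by
      rw [LinearMap.comp_apply, LinearMap.mulLeft_apply]
      exact pderiv_X_mul_mem_biHomog i j hP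

lemma pderivX_coe {a b : ℕ} (i j : Fin m) (P : biHomog m a b) :
    (pderivX m a b i j P : BiPoly m) = pderiv (Sum.inr i) (X (Sum.inr j) * (P : BiPoly m)) :=
  rfl

lemma trace_pderivX (a b : ℕ) (i j : Fin m) :
    LinearMap.trace ℂ _ (pderivX m a b i j) =
      if i = j then ∑ d : bidegreeSet m a b, ((d : Fin m ⊕ Fin m →₀ ℕ) (Sum.inr i) + 1 : ℂ)
      else 0 := by
  classical
  rw [LinearMap.trace_eq_matrix_trace ℂ (basisRestrictSupport ℂ (bidegreeSet m a b)),
    Matrix.trace]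
  have hdiag : ∀ d : bidegreeSet m a b,
      (LinearMap.toMatrix (basisRestrictSupport ℂ (bidegreeSet m a b))
        (basisRestrictSupport ℂ (bidegreeSet m a b)) (pderivX m a b i j)).diag d =
      coeff (d : Fin m ⊕ Fin m →₀ ℕ)
        (pderiv (Sum.inr i) (X (Sum.inr j) * monomial (d : Fin m ⊕ Fin m →₀ ℕ) (1 : ℂ))) := by
    intro d
    rw [Matrix.diag_apply, LinearMap.toMatrix_apply, basisRestrictSupport_repr_apply, pderivX_coe,
      basisRestrictSupport_apply]
  simp only [hdiag, coeff_pderiv, X, monomial_mul, coeff_monomial]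
  split_ifs with h
  · refine Finset.sum_congr rfl fun d _ => ?_
    simp [h, add_comm]
  · refine Finset.sum_eq_zero fun d _ => ?_
    rw [if_neg, zero_mul]
    intro h'
    apply h
    have := DFunLike.congr_fun h' (Sum.inr i)
    simp only [Finsupp.add_apply, Finsupp.single_apply, Sum.inr.injEq, if_true] at this
    split_ifs at this with h''
    · exact h''.symm
    · omega

lemma sum_trace_pderivX (a b : ℕ) :
    ∑ i, LinearMap.trace ℂ _ (pderivX m a b i i) =
      (Fintype.card (bidegreeSet m a b) : ℂ) * (b + m) := by
  simp only [trace_pderivX, if_true]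
  rw [Finset.sum_comm, Finset.sum_congr rfl (g := fun _ => (b + m : ℂ))]
  · rw [Finset.sum_const, Finset.card_univ, nsmul_eq_mul]
  · rintro ⟨d, -, hd⟩ -
    simp [Finset.sum_add_distrib, ← hd]

/-- The inclusion of the first `n - 1` indices. -/
abbrev inclFin (n : ℕ) : Fin (n - 1) → Fin n := Fin.castLE (Nat.sub_le n 1)

lemma inclFin_add_one_ne (i : Fin (n - 1)) : (inclFin n i : ℕ) + 1 ≠ n := by
  have := i.2
  simp
  omega

lemma card_filter_inclFin_notMem {r : ℕ} (s : LamQIndex n r) :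
    (Finset.univ.filter fun i => inclFin n i ∉ (s : Finset (Fin n))).card = n - r := by
  obtain ⟨s, hs, l, hl, hln⟩ := s
  subst hs
  change (Finset.univ.filter fun i => inclFin n i ∉ s).card = _
  have hc := Finset.card_compl s
  rw [Fintype.card_fin] at hc
  rw [← hc, ← Finset.card_map (Fin.castLEEmb (Nat.sub_le n 1))]
  congr 1
  ext j
  simp only [Finset.mem_map, Finset.mem_filter, Finset.mem_univ, true_and, Finset.mem_compl,
    Fin.castLEEmb_apply]
  constructor
  · rintro ⟨i, hi, rfl⟩
    exact hi
  · intro hj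
    have hjl : j ≠ l := by rintro rfl; exact hj hl
    have hjn : (j : ℕ) < n - 1 := by
      have := j.2
      have : (j : ℕ) ≠ l := fun h => hjl (Fin.ext h)
      omega
    exact ⟨⟨j, hjn⟩, hj, rfl⟩

lemma card_filter_notMem_LamQIndex {r : ℕ} (hr : 1 ≤ r) (i : Fin (n - 1)) :
    (Finset.univ.filter fun s : LamQIndex n r => inclFin n i ∉ (s : Finset (Fin n))).card =
      (n - 2).choose (r - 1) := by
  have hn : n - 1 < n := by have := i.2; omega
  let l : Fin n := ⟨n - 1, hn⟩
  have hli : l ≠ inclFin n i := fun h => by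
    have := congrArg Fin.val h
    have := i.2
    simp [l] at *
    omega
  have hcard : (({l, inclFin n i} : Finset (Fin n))ᶜ).card = n - 2 := by
    rw [Finset.card_compl, Finset.card_pair hli, Fintype.card_fin]
  rw [← hcard, ← Finset.card_powersetCard]
  have hl : ∀ s : LamQIndex n r, l ∈ (s : Finset (Fin n)) := by
    rintro ⟨s, -, j, hj, hjn⟩
    have : j = l := Fin.ext (by simp only [l]; omega)
    exact this ▸ hj
  have hlt : ∀ t ∈ Finset.powersetCard (r - 1) ({l, inclFin n i} : Finset (Fin n))ᶜ, l ∉ t :=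
    fun t ht h => by simpa using (Finset.mem_powersetCard.mp ht).1 h
  refine Finset.card_bij' (fun s _ => (s : Finset (Fin n)).erase l)
    (fun t ht => ⟨insert l t, ?_, l, Finset.mem_insert_self _ _, ?_⟩) ?_ ?_ ?_ ?_
  · rw [Finset.card_insert_of_notMem (hlt t ht), (Finset.mem_powersetCard.mp ht).2]
    omega
  · simp only [l]
    omega
  · intro s hs
    rw [Finset.mem_powersetCard, Finset.card_erase_of_mem (hl s), s.2.1]
    refine ⟨fun k hk => ?_, rfl⟩
    rw [Finset.mem_erase] at hk
    simp only [Finset.mem_compl, Finset.mem_insert, Finset.mem_singleton, not_or]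
    refine ⟨hk.1, ?_⟩
    rintro rfl
    exact (Finset.mem_filter.mp hs).2 hk.2
  · intro t ht
    refine Finset.mem_filter.mpr ⟨Finset.mem_univ _, fun h => ?_⟩
    rcases Finset.mem_insert.mp h with h | h
    · exact hli h.symm
    · simpa using (Finset.mem_powersetCard.mp ht).1 h
  · intro s _
    exact Subtype.ext (Finset.insert_erase (hl s))
  · intro t ht
    exact Finset.erase_insert (hlt t ht)

/-- The operator `x ↦ 𝔣_i 𝔣_j† x` on `LamQ n r`. -/
def ffMulFfd (n r : ℕ) (i j : Fin (n - 1)) : Module.End ℂ (LamQ n r) :=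
  (LinearMap.mulLeft ℂ (ff n (inclFin n i) * ffd n (inclFin n j))).restrict
    fun x hx => by
      rw [LinearMap.mulLeft_apply]
      exact ff_mul_ffd_mul_mem_LamQ (inclFin_add_one_ne i) _ hx

lemma ffMulFfd_coe {r : ℕ} (i j : Fin (n - 1)) (x : LamQ n r) :
    (ffMulFfd n r i j x : Cl n) = ff n (inclFin n i) * (ffd n (inclFin n j) * (x : Cl n)) := by
  rw [ffMulFfd, LinearMap.coe_restrict_apply, LinearMap.mulLeft_apply, mul_assoc]

lemma trace_ffMulFfd {r : ℕ} (hr : 1 ≤ r) (i : Fin (n - 1)) :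
    LinearMap.trace ℂ _ (ffMulFfd n r i i) = ((n - 2).choose (r - 1) : ℂ) := by
  classical
  rw [LinearMap.trace_eq_matrix_trace ℂ (basisLamQ n r), Matrix.trace,
    ← card_filter_notMem_LamQIndex hr i, Finset.card_filter, Nat.cast_sum]
  refine Finset.sum_congr rfl fun s _ => ?_
  have h : ffMulFfd n r i i (basisLamQ n r s) =
      if inclFin n i ∈ (s : Finset (Fin n)) then 0 else basisLamQ n r s := by
    apply Subtype.ext
    change ff n (inclFin n i) * ffd n (inclFin n i) * (basisLamQ n r s : Cl n) = _
    rw [basisLamQ_apply, mul_assoc, ff_mul_ffd_mul_blade]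
    split_ifs
    · rfl
    · rw [basisLamQ_apply]
  rw [Matrix.diag_apply, LinearMap.toMatrix_apply, h]
  split_ifs <;> simp

lemma sum_ff_mul_ffd_mul {r : ℕ} (hrn : r ≤ n) {x : Cl n} (hx : x ∈ LamQ n r) :
    ∑ i, ff n (inclFin n i) * (ffd n (inclFin n i) * x) = ((n : ℂ) - r) • x := by
  have key : Set.EqOn
      (∑ i, LinearMap.mulLeft ℂ (ff n (inclFin n i) * ffd n (inclFin n i)) : Cl n →ₗ[ℂ] Cl n)
      (((n : ℂ) - r) • LinearMap.id : Cl n →ₗ[ℂ] Cl n)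
      (Set.range fun s : LamQIndex n r => blade n s) := by
    rintro _ ⟨s, rfl⟩
    simp only [LinearMap.sum_apply, LinearMap.mulLeft_apply, mul_assoc, ff_mul_ffd_mul_blade,
      LinearMap.smul_apply, LinearMap.id_apply]
    rw [← Nat.cast_sub hrn, ← card_filter_inclFin_notMem s, Nat.cast_smul_eq_nsmul,
      Finset.card_filter, Finset.sum_smul]
    refine Finset.sum_congr rfl fun i _ => ?_
    split_ifs <;> simp
  have h := LinearMap.eqOn_span key (x := x) (by rwa [span_range_blade])
  simpa [mul_assoc] using h

/-- The formal counterpart of the restricted Hermitean Dirac operator `∂_z̃†`. -/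
def diracOp (n : ℕ) : Module.End ℂ (BiPoly (n - 1) ⊗[ℂ] Cl n) :=
  ∑ i, TensorProduct.map (pderiv (Sum.inr i)).toLinearMap (LinearMap.mulLeft ℂ (ff n (inclFin n i)))

/-- The operator of multiplication with `∑_j z_j^c 𝔣_j†`. -/
def vectorOp (n : ℕ) : Module.End ℂ (BiPoly (n - 1) ⊗[ℂ] Cl n) :=
  ∑ i, TensorProduct.map (LinearMap.mulLeft ℂ (X (Sum.inr i)))
    (LinearMap.mulLeft ℂ (ffd n (inclFin n i)))

lemma diracOp_tmul (P : BiPoly (n - 1)) (x : Cl n) :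
    diracOp n (P ⊗ₜ x) = ∑ i, pderiv (Sum.inr i) P ⊗ₜ (ff n (inclFin n i) * x) := by
  simp [diracOp]

lemma vectorOp_tmul (P : BiPoly (n - 1)) (x : Cl n) :
    vectorOp n (P ⊗ₜ x) = ∑ i, (X (Sum.inr i) * P) ⊗ₜ (ffd n (inclFin n i) * x) := by
  simp [vectorOp]

lemma pderiv_comm {σ : Type*} (i j : σ) (P : MvPolynomial σ ℂ) :
    pderiv i (pderiv j P) = pderiv j (pderiv i P) := by
  classical
  have h : (⁅pderiv i, pderiv j⁆ : Derivation ℂ (MvPolynomial σ ℂ) (MvPolynomial σ ℂ)) = 0 :=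
    derivation_ext fun k => by
      rw [Derivation.commutator_apply, pderiv_X, pderiv_X, Pi.single_apply, Pi.single_apply]
      split_ifs <;> simp
  have := DFunLike.congr_fun h P
  rwa [Derivation.commutator_apply, Derivation.zero_apply, sub_eq_zero] at this

lemma diracOp_diracOp (w : BiPoly (n - 1) ⊗[ℂ] Cl n) : diracOp n (diracOp n w) = 0 := by
  induction w using TensorProduct.induction_on with
  | zero => simp
  | tmul P x =>
    have h : diracOp n (diracOp n (P ⊗ₜ x)) = -diracOp n (diracOp n (P ⊗ₜ x)) := by
      simp only [diracOp_tmul, map_sum]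
      conv_rhs => rw [Finset.sum_comm]
      simp only [← Finset.sum_neg_distrib]
      refine Finset.sum_congr rfl fun i _ => Finset.sum_congr rfl fun j _ => ?_
      rw [pderiv_comm, ← mul_assoc, ff_mul_ff, neg_mul, mul_assoc, TensorProduct.tmul_neg]
    have h2 : (2 : ℂ) • diracOp n (diracOp n (P ⊗ₜ x)) = 0 := by
      rw [two_smul, add_eq_zero_iff_eq_neg, ← h]
    exact (smul_eq_zero.mp h2).resolve_left two_ne_zero
  | add u v hu hv => rw [map_add, map_add, hu, hv, add_zero]

lemma diracOp_vectorOp_add (P : BiPoly (n - 1)) (x : Cl n) :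
    diracOp n (vectorOp n (P ⊗ₜ x)) + vectorOp n (diracOp n (P ⊗ₜ x)) =
      P ⊗ₜ (∑ i, ff n (inclFin n i) * (ffd n (inclFin n i) * x)) +
        (∑ i, X (Sum.inr i) * pderiv (Sum.inr i) P) ⊗ₜ x := by
  simp only [diracOp_tmul, vectorOp_tmul, map_sum]
  conv_lhs => enter [1]; rw [Finset.sum_comm]
  rw [← Finset.sum_add_distrib, TensorProduct.tmul_sum, TensorProduct.sum_tmul,
    ← Finset.sum_add_distrib]
  refine Finset.sum_congr rfl fun i _ => ?_
  rw [← Finset.sum_add_distrib]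
  have hterm : ∀ j, pderiv (Sum.inr i) (X (Sum.inr j) * P) ⊗ₜ[ℂ]
      (ff n (inclFin n i) * (ffd n (inclFin n j) * x)) +
      (X (Sum.inr j) * pderiv (Sum.inr i) P) ⊗ₜ[ℂ]
        (ffd n (inclFin n j) * (ff n (inclFin n i) * x)) =
      if j = i then P ⊗ₜ[ℂ] (ff n (inclFin n i) * (ffd n (inclFin n i) * x)) +
        (X (Sum.inr i) * pderiv (Sum.inr i) P) ⊗ₜ[ℂ] x else 0 := by
    intro j
    have hanti : ff n (inclFin n i) * (ffd n (inclFin n j) * x) +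
        ffd n (inclFin n j) * (ff n (inclFin n i) * x) = if j = i then x else 0 := by
      rw [← mul_assoc, ff_mul_ffd, sub_mul, mul_assoc, sub_add_cancel, ite_mul, one_mul, zero_mul]
      simp only [(Fin.castLE_injective _).eq_iff, eq_comm]
    rw [pderiv_mul, pderiv_X, TensorProduct.add_tmul, add_assoc, ← TensorProduct.tmul_add, hanti]
    by_cases h : j = i
    · subst h
      simp
    · simp [h]
  rw [Finset.sum_congr rfl fun j _ => hterm j, Finset.sum_ite_eq' _ i, if_pos (Finset.mem_univ i)]

/-- The inclusion of the formal counterpart of `𝒬_{a,b,r}`. -/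
abbrev inclQ (n a b r : ℕ) : biHomog (n - 1) a b ⊗[ℂ] LamQ n r →ₗ[ℂ] BiPoly (n - 1) ⊗[ℂ] Cl n :=
  TensorProduct.mapIncl (biHomog (n - 1) a b) (LamQ n r)

lemma inclQ_injective (a b r : ℕ) : Function.Injective (inclQ n a b r) :=
  TensorProduct.map_injective_of_flat_flat _ _ (Submodule.subtype_injective _)
    (Submodule.subtype_injective _)

lemma diracOp_vectorOp_add_inclQ {a b r : ℕ} (hrn : r ≤ n)
    (k : biHomog (n - 1) a b ⊗[ℂ] LamQ n r) :
    diracOp n (vectorOp n (inclQ n a b r k)) + vectorOp n (diracOp n (inclQ n a b r k)) =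
      ((b : ℂ) + n - r) • inclQ n a b r k := by
  induction k using TensorProduct.induction_on with
  | zero => simp
  | tmul P x =>
    rw [inclQ, TensorProduct.mapIncl, TensorProduct.map_tmul, diracOp_vectorOp_add]
    simp only [Submodule.subtype_apply]
    rw [sum_ff_mul_ffd_mul hrn x.2, sum_X_mul_pderiv P.2, TensorProduct.tmul_smul,
      ← TensorProduct.smul_tmul', ← add_smul]
    congr 1
    ring
  | add u v hu hv =>
    simp only [map_add, smul_add, ← hu, ← hv]
    abel

/-- The restriction of `∂_z̃† (∑_j z_j^c 𝔣_j†)` to the formal counterpart of `𝒬_{a,b,r}`. -/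
def diracVectorQ (n a b r : ℕ) : Module.End ℂ (biHomog (n - 1) a b ⊗[ℂ] LamQ n r) :=
  ∑ i, ∑ j, TensorProduct.map (pderivX (n - 1) a b i j) (ffMulFfd n r i j)

lemma inclQ_diracVectorQ {a b r : ℕ} (k : biHomog (n - 1) a b ⊗[ℂ] LamQ n r) :
    inclQ n a b r (diracVectorQ n a b r k) = diracOp n (vectorOp n (inclQ n a b r k)) := by
  induction k using TensorProduct.induction_on with
  | zero => simp
  | tmul P x =>
    simp only [diracVectorQ, LinearMap.sum_apply, TensorProduct.map_tmul, map_sum,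
      Submodule.subtype_apply, vectorOp_tmul, diracOp_tmul]
    conv_rhs => rw [Finset.sum_comm]
    refine Finset.sum_congr rfl fun i _ => Finset.sum_congr rfl fun j _ => ?_
    rw [pderivX_coe, ffMulFfd_coe]
  | add u v hu hv => simp only [map_add, hu, hv]

lemma trace_diracVectorQ {r : ℕ} (hr : 1 ≤ r) (a b : ℕ) :
    LinearMap.trace ℂ _ (diracVectorQ n a b r) =
      (Fintype.card (bidegreeSet (n - 1) a b) : ℂ) * (b + (n - 1 : ℕ)) *
        ((n - 2).choose (r - 1) : ℂ) := by
  rw [← sum_trace_pderivX, Finset.sum_mul]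
  simp only [diracVectorQ, map_sum]
  refine Finset.sum_congr rfl fun i _ => ?_
  rw [Finset.sum_eq_single i]
  · rw [LinearMap.trace_tensorProduct', trace_ffMulFfd hr]
  · intro j _ hj
    rw [LinearMap.trace_tensorProduct', trace_pderivX, if_neg hj.symm, zero_mul]
  · simp

lemma free_and_finite_submodule {V : Type*} [AddCommMonoid V] [Module ℂ V] [Module.Finite ℂ V]
    (p : Submodule ℂ V) : Module.Free ℂ p ∧ Module.Finite ℂ p := by
  let : AddCommGroup V := Module.addCommMonoidToAddCommGroup ℂ
  exact ⟨inferInstance, inferInstance⟩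

lemma trace_eq_finrank_of_isProj {V : Type*} [AddCommMonoid V] [Module ℂ V] [Module.Finite ℂ V]
    {p : Submodule ℂ V} {f : Module.End ℂ V} (h : LinearMap.IsProj p f) :
    LinearMap.trace ℂ V f = Module.finrank ℂ p := by
  let : AddCommGroup V := Module.addCommMonoidToAddCommGroup ℂ
  exact h.trace

/-- The formal counterpart of `𝒴_{a,b,r}`. -/
def kerDiracQ (n a b r : ℕ) : Submodule ℂ (biHomog (n - 1) a b ⊗[ℂ] LamQ n r) :=
  LinearMap.ker (diracOp n ∘ₗ inclQ n a b r)

instance (a b r : ℕ) : Module.Free ℂ (kerDiracQ n a b r) := (free_and_finite_submodule _).1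

instance (a b r : ℕ) : Module.Finite ℂ (kerDiracQ n a b r) := (free_and_finite_submodule _).2

lemma isProj_diracVectorQ {a b r : ℕ} (hrn : r ≤ n) (h0 : (b : ℂ) + n - r ≠ 0) :
    LinearMap.IsProj (kerDiracQ n a b r) (((b : ℂ) + n - r)⁻¹ • diracVectorQ n a b r) where
  map_mem k := by
    refine Submodule.smul_mem _ _ (LinearMap.mem_ker.mpr ?_)
    rw [LinearMap.comp_apply, inclQ_diracVectorQ, diracOp_diracOp]
  map_id k hk := by
    have hk' : diracOp n (inclQ n a b r k) = 0 := hk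
    apply inclQ_injective
    have h := diracOp_vectorOp_add_inclQ hrn k
    rw [hk', map_zero, add_zero] at h
    rw [LinearMap.smul_apply, map_smul, inclQ_diracVectorQ, h, inv_smul_smul₀ h0]

lemma finrank_kerDiracQ {a b r : ℕ} (hr : 1 ≤ r) (hrn : r < n) :
    ((b : ℂ) + n - r) * Module.finrank ℂ (kerDiracQ n a b r) =
      (Fintype.card (bidegreeSet (n - 1) a b) : ℂ) * (b + (n - 1 : ℕ)) *
        ((n - 2).choose (r - 1) : ℂ) := by
  have h0 : (b : ℂ) + n - r ≠ 0 := by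
    have h : ((b + (n - r) : ℕ) : ℂ) ≠ 0 := Nat.cast_ne_zero.mpr (by omega)
    rwa [Nat.cast_add, Nat.cast_sub hrn.le, ← add_sub_assoc] at h
  have h := trace_eq_finrank_of_isProj (isProj_diracVectorQ (a := a) hrn.le h0)
  rw [map_smul, trace_diracVectorQ hr, smul_eq_mul] at h
  rw [← h, mul_inv_cancel_left₀ h0]

end Dimension

section Polynomials

open MvPolynomial

variable {m n : ℕ}

lemma dzdT_evalCl (w : BiPoly (n - 1) ⊗[ℂ] Cl n) (z : Fin (n - 1) → ℂ) :
    dzdT n (evalCl n (n - 1) w) z = evalCl n (n - 1) (diracOp n w) z := by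
  simp only [dzdT, diracOp, LinearMap.sum_apply, map_sum, Finset.sum_apply, pzc_evalCl,
    map_mulLeft_evalCl]
  refine Finset.sum_congr rfl fun j _ => ?_
  rw [← LinearMap.comp_apply (TensorProduct.map _ _), ← TensorProduct.map_comp, LinearMap.id_comp,
    LinearMap.comp_id]

lemma IsPolyMap.add {p q : (Fin m → ℂ) → Cl n} (hp : IsPolyMap n m p) (hq : IsPolyMap n m q) :
    IsPolyMap n m (p + q) := by
  obtain ⟨N, c, dx, dy, hp⟩ := hp
  obtain ⟨N', c', dx', dy', hq⟩ := hq
  refine ⟨N + N', Fin.append c c', Fin.append dx dx', Fin.append dy dy', fun z => ?_⟩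
  simp only [Pi.add_apply, hp, hq, Fin.sum_univ_add, Fin.append_left, Fin.append_right]

lemma eval_conjPair_monomial (z : Fin m → ℂ) (d : Fin m ⊕ Fin m →₀ ℕ) (c : ℂ) :
    eval (conjPair z) (monomial d c) =
      c * ∏ j, z j ^ d (Sum.inl j) * (starRingEnd ℂ) (z j) ^ d (Sum.inr j) := by
  rw [eval_monomial, Finsupp.prod_fintype _ _ fun _ => pow_zero _, Fintype.prod_sum_type,
    Finset.prod_mul_distrib]
  rfl

lemma isPolyMap_evalCl (w : BiPoly m ⊗[ℂ] Cl n) : IsPolyMap n m (evalCl n m w) := by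
  induction w using TensorProduct.induction_on with
  | zero => exact ⟨0, Fin.elim0, Fin.elim0, Fin.elim0, fun z => by simp⟩
  | tmul P x =>
    induction P using MvPolynomial.induction_on' with
    | monomial d c =>
      refine ⟨1, fun _ => c • x, fun _ j => d (Sum.inl j), fun _ j => d (Sum.inr j), fun z => ?_⟩
      rw [evalCl_tmul, eval_conjPair_monomial, Fin.sum_univ_one, smul_smul, mul_comm]
    | add P Q hP hQ =>
      rw [TensorProduct.add_tmul, map_add]
      exact hP.add hQ
  | add u v hu hv =>
    rw [map_add]
    exact hu.add hv

lemma prod_pow_smul (dx dy : Fin m → ℕ) (c : ℂ) (z : Fin m → ℂ) :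
    ∏ j, (c • z) j ^ dx j * (starRingEnd ℂ) ((c • z) j) ^ dy j =
      (c ^ ∑ j, dx j) * (starRingEnd ℂ) c ^ (∑ j, dy j) *
        ∏ j, z j ^ dx j * (starRingEnd ℂ) (z j) ^ dy j := by
  simp only [Pi.smul_apply, smul_eq_mul, map_mul, mul_pow, Finset.prod_mul_distrib,
    Finset.prod_pow_eq_pow_sum]
  ring

lemma eval_conjPair_smul {a b : ℕ} {P : BiPoly m} (hP : P ∈ biHomog m a b) (c : ℂ)
    (z : Fin m → ℂ) :
    eval (conjPair (c • z)) P = c ^ a * (starRingEnd ℂ) c ^ b * eval (conjPair z) P := by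
  rw [biHomog, restrictSupport_eq_span] at hP
  induction hP using Submodule.span_induction with
  | mem P hP =>
    obtain ⟨d, ⟨hd1, hd2⟩, rfl⟩ := hP
    rw [eval_conjPair_monomial, eval_conjPair_monomial, one_mul, one_mul, prod_pow_smul, hd1, hd2]
  | zero => simp
  | add P Q _ _ hP hQ => rw [map_add, map_add, hP, hQ, mul_add]
  | smul x P _ hP =>
    rw [smul_eval, smul_eval, hP]
    ring

lemma isBihom_evalCl_inclQ {a b r : ℕ} (k : biHomog (n - 1) a b ⊗[ℂ] LamQ n r) :
    IsBihom n (n - 1) a b (evalCl n (n - 1) (inclQ n a b r k)) := by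
  refine ⟨isPolyMap_evalCl _, fun c z => ?_⟩
  induction k using TensorProduct.induction_on with
  | zero => simp
  | tmul P x =>
    rw [inclQ, TensorProduct.mapIncl, TensorProduct.map_tmul, evalCl_tmul, evalCl_tmul,
      Submodule.subtype_apply, eval_conjPair_smul P.2, mul_smul]
  | add u v hu hv => simp only [map_add, Pi.add_apply, smul_add, hu, hv]

lemma evalCl_inclQ_mem_LamQ {a b r : ℕ} (k : biHomog (n - 1) a b ⊗[ℂ] LamQ n r)
    (z : Fin (n - 1) → ℂ) : evalCl n (n - 1) (inclQ n a b r k) z ∈ LamQ n r := by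
  induction k using TensorProduct.induction_on with
  | zero => simp
  | tmul P x =>
    rw [inclQ, TensorProduct.mapIncl, TensorProduct.map_tmul, evalCl_tmul]
    exact Submodule.smul_mem _ _ x.2
  | add u v hu hv =>
    rw [map_add, map_add, Pi.add_apply]
    exact Submodule.add_mem _ hu hv

/-- Only the terms of bidegree `(a, b)` contribute to a bihomogeneous polynomial map. -/
lemma eq_sum_ite_of_homogeneous {a b N : ℕ} {p : (Fin m → ℂ) → Cl n}
    {c : Fin N → Cl n} {dx dy : Fin N → Fin m → ℕ}
    (hp : ∀ z, p z = ∑ t, (∏ j, (z j) ^ dx t j * (starRingEnd ℂ) (z j) ^ dy t j) • c t)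
    (hh : ∀ (w : ℂ) (z : Fin m → ℂ), p (w • z) = (w ^ a * (starRingEnd ℂ) w ^ b) • p z)
    (z : Fin m → ℂ) :
    p z = ∑ t, if ∑ j, dx t j = a ∧ ∑ j, dy t j = b then
      (∏ j, (z j) ^ dx t j * (starRingEnd ℂ) (z j) ^ dy t j) • c t else 0 := by
  classical
  rw [← sub_eq_zero, ← Module.forall_dual_apply_eq_zero_iff ℂ]
  intro φ
  let d (k l : ℕ) : Fin 1 ⊕ Fin 1 →₀ ℕ :=
    Finsupp.single (Sum.inl 0) k + Finsupp.single (Sum.inr 0) l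
  have hd : ∀ k l k' l', d k l = d k' l' ↔ k = k' ∧ l = l' := by
    refine fun k l k' l' => ⟨fun h => ⟨?_, ?_⟩, by rintro ⟨rfl, rfl⟩; rfl⟩
    · simpa [d] using DFunLike.congr_fun h (Sum.inl 0)
    · simpa [d] using DFunLike.congr_fun h (Sum.inr 0)
  let M (t : Fin N) : ℂ := ∏ j, (z j) ^ dx t j * (starRingEnd ℂ) (z j) ^ dy t j
  let Q : BiPoly 1 := monomial (d a b) (φ (p z)) -
    ∑ t, monomial (d (∑ j, dx t j) (∑ j, dy t j)) (M t * φ (c t))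
  have hQ : Q = 0 := by
    refine eq_zero_of_eval_conjPair fun w => ?_
    have h := congrArg φ (hh (w 0) z)
    rw [hp (w 0 • z)] at h
    simp only [map_sum, map_smul, prod_pow_smul, smul_eq_mul] at h
    simp only [Q, map_sub, map_sum, eval_conjPair_monomial, Fin.prod_univ_one]
    rw [sub_eq_zero, mul_comm]
    simp only [d, Finsupp.add_apply, Finsupp.single_apply, reduceCtorEq, if_true, if_false,
      add_zero, zero_add]
    rw [← h]
    exact Finset.sum_congr rfl fun t _ => by ring
  have hcoeff := congrArg (coeff (d a b)) hQ
  simp only [Q, coeff_sub, coeff_sum, coeff_monomial, hd, coeff_zero, if_true] at hcoeff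
  rw [map_sub, map_sum, ← hcoeff]
  congr 1
  refine Finset.sum_congr rfl fun t _ => ?_
  split_ifs
  · rw [map_smul, smul_eq_mul]
  · rw [map_zero]

lemma exists_evalCl_inclQ_eq {a b r : ℕ} {p : (Fin (n - 1) → ℂ) → Cl n}
    (hp : IsBihom n (n - 1) a b p) (hpQ : ∀ z, p z ∈ LamQ n r) :
    ∃ k, evalCl n (n - 1) (inclQ n a b r k) = p := by
  classical
  obtain ⟨⟨N, c, dx, dy, hp⟩, hh⟩ := hp
  obtain ⟨π, hπ⟩ := (LamQ n r).subtype.exists_leftInverse_of_injective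
    (LinearMap.ker_eq_bot.mpr (LamQ n r).subtype_injective)
  have hmem : ∀ t, (∑ j, dx t j = a ∧ ∑ j, dy t j = b) →
      monomial (Finsupp.equivFunOnFinite.symm (Sum.elim (dx t) (dy t))) (1 : ℂ) ∈
        biHomog (n - 1) a b := fun t ht => by
    rw [monomial_mem_restrictSupport]
    exact Or.inl ht
  refine ⟨∑ t, if h : ∑ j, dx t j = a ∧ ∑ j, dy t j = b then
    (⟨_, hmem t h⟩ : biHomog (n - 1) a b) ⊗ₜ π (c t) else 0, ?_⟩
  funext z
  have hz : (π (p z) : Cl n) = p z :=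
    congrArg Subtype.val (LinearMap.congr_fun hπ ⟨p z, hpQ z⟩)
  rw [← hz, eq_sum_ite_of_homogeneous hp hh z]
  simp only [map_sum, Finset.sum_apply, Submodule.coe_sum]
  refine Finset.sum_congr rfl fun t _ => ?_
  split_ifs with h
  · rw [inclQ, TensorProduct.mapIncl, TensorProduct.map_tmul, evalCl_tmul]
    simp only [Submodule.subtype_apply, map_smul, Submodule.coe_smul, eval_conjPair_monomial,
      one_mul]
    rfl
  · simp

end Polynomials

lemma finrank_kerDiracQ_eq {n r : ℕ} (a b : ℕ) (hn : 2 ≤ n) (hr1 : 1 ≤ r) (hrn : r ≤ n - 1) :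
    (Module.finrank ℂ (kerDiracQ n a b r) : ℚ) =
      (r : ℚ) / ((b : ℚ) + n - r) * (Nat.choose (n - 1) r : ℚ) *
        (Nat.choose (a + n - 2) a : ℚ) * (Nat.choose (b + n - 1) b : ℚ) := by
  obtain ⟨n, rfl⟩ := Nat.exists_eq_add_of_le' hn
  obtain ⟨r, rfl⟩ := Nat.exists_eq_add_of_le' hr1
  have hrn' : r ≤ n := by omega
  have h := finrank_kerDiracQ (a := a) (b := b) hr1 (by omega : r + 1 < n + 2)
  rw [card_bidegreeSet] at h
  obtain ⟨l, rfl⟩ := Nat.exists_eq_add_of_le hrn'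
  simp only [show r + l + 2 - 1 = r + l + 1 by omega, show r + l + 2 - 2 = r + l by omega,
    Nat.add_sub_cancel, show r + l + 1 + a - 1 = a + (r + l) by omega,
    show r + l + 1 + b - 1 = b + (r + l) by omega, show a + (r + l + 2) - 2 = a + (r + l) by omega,
    show b + (r + l + 2) - 1 = b + (r + l) + 1 by omega] at h ⊢
  generalize Module.finrank ℂ (kerDiracQ (r + l + 2) a b (r + 1)) = f at h ⊢
  have hN : (b + l + 1) * f = (a + (r + l)).choose a * (b + (r + l)).choose b * (b + (r + l) + 1) *
      (r + l).choose r := by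
    have h' : (((b + l + 1) * f : ℕ) : ℂ) = (((a + (r + l)).choose a * (b + (r + l)).choose b *
        (b + (r + l) + 1) * (r + l).choose r : ℕ) : ℂ) := by
      push_cast at h ⊢
      linear_combination h
    exact_mod_cast h'
  have h1 : (r + l + 1) * (r + l).choose r = (r + l + 1).choose (r + 1) * (r + 1) :=
    Nat.add_one_mul_choose_eq (r + l) r
  have h2 : (b + (r + l) + 1) * (b + (r + l)).choose b =
      (b + (r + l) + 1).choose b * (r + l + 1) := by
    have := Nat.add_one_mul_choose_eq (b + (r + l)) (r + l)
    rwa [← Nat.choose_symm_add,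
      ← Nat.choose_symm_of_eq_add (by ring : b + (r + l) + 1 = b + (r + l + 1))] at this
  have h0 : (b : ℚ) + l + 1 ≠ 0 := by positivity
  have hN' := congrArg (Nat.cast (R := ℚ)) hN
  have h1' := congrArg (Nat.cast (R := ℚ)) h1
  have h2' := congrArg (Nat.cast (R := ℚ)) h2
  push_cast at hN' h1' h2' ⊢
  rw [show (b : ℚ) + (r + l + 2) - (r + 1) = b + l + 1 by ring]
  field_simp
  linear_combination hN' + ((a + (r + l)).choose a : ℚ) * (r + l).choose r * h2' +
    ((a + (r + l)).choose a : ℚ) * (b + (r + l) + 1).choose b * h1'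

/-- **Dimension of `𝒴_{a,b,r} = Ker ∂_z̃† ∩ 𝒬_{a,b,r}`:** the space of bidegree-`(a,b)`
homogeneous polynomials `ℂ^{n-1} → (∧_{n-1}†)^{(r-1)} 𝔣_n† I` killed by `∂_z̃†` has dimension
`y_{a,b,r} = (r/(b+n-r)) C(n-1,r) C(a+n-2,a) C(b+n-1,b)`, witnessed by a spanning linearly
independent family of that cardinality. -/
theorem dim_ker_dzdT (n : ℕ) (hn : 2 ≤ n) (a b r : ℕ) (hr1 : 1 ≤ r) (hrn : r ≤ n - 1) :
    ∃ d : ℕ,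
      (d : ℚ) = (r : ℚ) / ((b : ℚ) + n - r) * (Nat.choose (n - 1) r : ℚ) *
        (Nat.choose (a + n - 2) a : ℚ) * (Nat.choose (b + n - 1) b : ℚ) ∧
      ∃ g : Fin d → ((Fin (n - 1) → ℂ) → Cl n),
        (∀ t, IsBihom n (n - 1) a b (g t) ∧ (∀ z, g t z ∈ LamQ n r) ∧
          (∀ z, dzdT n (g t) z = 0)) ∧
        LinearIndependent ℂ g ∧
        ∀ p : (Fin (n - 1) → ℂ) → Cl n,
          (IsBihom n (n - 1) a b p ∧ (∀ z, p z ∈ LamQ n r) ∧ (∀ z, dzdT n p z = 0)) →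
            p ∈ Submodule.span ℂ (Set.range g) := by
  let Φ : kerDiracQ n a b r →ₗ[ℂ] ((Fin (n - 1) → ℂ) → Cl n) :=
    evalCl n (n - 1) ∘ₗ inclQ n a b r ∘ₗ (kerDiracQ n a b r).subtype
  have hΦ : Function.Injective Φ :=
    evalCl_injective.comp ((inclQ_injective a b r).comp (Submodule.subtype_injective _))
  let B := Module.finBasis ℂ (kerDiracQ n a b r)
  refine ⟨_, finrank_kerDiracQ_eq a b hn hr1 hrn, fun t => Φ (B t), fun t => ⟨?_, ?_, ?_⟩,
    B.linearIndependent.map_injOn Φ hΦ.injOn, ?_⟩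
  · exact isBihom_evalCl_inclQ _
  · exact evalCl_inclQ_mem_LamQ _
  · intro z
    have h : diracOp n (inclQ n a b r (B t)) = 0 := (B t).2
    change dzdT n (evalCl n (n - 1) (inclQ n a b r (B t))) z = 0
    rw [dzdT_evalCl, h, map_zero, Pi.zero_apply]
  · rintro p ⟨hp, hpQ, hp0⟩
    obtain ⟨k, rfl⟩ := exists_evalCl_inclQ_eq hp hpQ
    have hk : k ∈ kerDiracQ n a b r := evalCl_injective <| by
      funext z
      rw [map_zero, Pi.zero_apply, ← hp0 z, dzdT_evalCl]
      rfl
    rw [Set.range_comp' Φ B, ← Submodule.map_span, B.span_eq]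
    exact ⟨⟨k, hk⟩, Submodule.mem_top, rfl⟩
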